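/- Let (V,X,Y,W,Z) be random variables on finite sets with joint distribution p(v,x,y,w,z) satisfying the Markov chains V − X − (Y,W,Z) and (V,X,Z) − Y − W (equivalently, p(v,x,y,w,z) = p(x,y,z)·p(v|x)·p(w|y)). Then H(f(X,Y,Z)|V,W,Z) = 0 if and only if for all v, w, z and all x₁,x₂ in the support set {x : p(v,x) > 0} of v and all y₁,y₂ in the support set {y : p(w,y) > 0} of w with p(x₁,y₁,z)·p(x₂,y₂,z) > 0, one has f(x₁,y₁,z) = f(x₂,y₂,z). -/

import Mathlib

open Finset

attribute [local instance] Classical.propDecidable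

noncomputable section

/-- Probability of an event under a probability mass function on a finite sample space. -/
def pr {Ω : Type} [Fintype Ω] (μ : Ω → ℝ) (E : Set Ω) : ℝ :=
  ∑ ω, if ω ∈ E then μ ω else 0

/-- The distribution (law) of a random variable `X` under `μ`. -/
def law {Ω 𝒜 : Type} [Fintype Ω] (μ : Ω → ℝ) (X : Ω → 𝒜) : 𝒜 → ℝ :=
  fun a => pr μ {ω | X ω = a}

/-- Shannon entropy (base 2) of a discrete random variable. -/
def ent {Ω 𝒜 : Type} [Fintype Ω] [Fintype 𝒜] (μ : Ω → ℝ) (X : Ω → 𝒜) : ℝ :=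
  -∑ a, law μ X a * Real.logb 2 (law μ X a)

/-- Conditional entropy `H(X|Y) = H(X,Y) - H(Y)`. -/
def condEnt {Ω 𝒜 ℬ : Type} [Fintype Ω] [Fintype 𝒜] [Fintype ℬ]
    (μ : Ω → ℝ) (X : Ω → 𝒜) (Y : Ω → ℬ) : ℝ :=
  ent μ (fun ω => (X ω, Y ω)) - ent μ Y

/-- Mutual information `I(X;Y)`. -/
def mutInf {Ω 𝒜 ℬ : Type} [Fintype Ω] [Fintype 𝒜] [Fintype ℬ]
    (μ : Ω → ℝ) (X : Ω → 𝒜) (Y : Ω → ℬ) : ℝ :=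
  ent μ X + ent μ Y - ent μ (fun ω => (X ω, Y ω))

/-- Conditional mutual information `I(X;Y|Z)`. -/
def condMutInf {Ω 𝒜 ℬ 𝒞 : Type} [Fintype Ω] [Fintype 𝒜] [Fintype ℬ] [Fintype 𝒞]
    (μ : Ω → ℝ) (X : Ω → 𝒜) (Y : Ω → ℬ) (Z : Ω → 𝒞) : ℝ :=
  condEnt μ X Z + condEnt μ Y Z - condEnt μ (fun ω => (X ω, Y ω)) Z

/-- Markov chain `U − V − W`: `U` and `W` are conditionally independent given `V`. -/
def MarkovChain {Ω 𝒜 ℬ 𝒞 : Type} [Fintype Ω]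
    (μ : Ω → ℝ) (U : Ω → 𝒜) (V : Ω → ℬ) (W : Ω → 𝒞) : Prop :=
  ∀ a b c, pr μ {ω | U ω = a ∧ V ω = b ∧ W ω = c} * pr μ {ω | V ω = b}
    = pr μ {ω | U ω = a ∧ V ω = b} * pr μ {ω | V ω = b ∧ W ω = c}

/-- `⌈2^{nR}⌉`, the number of messages available at blocklength `n` and rate `R`. -/
def codeSize (n : ℕ) (R : ℝ) : ℕ := Nat.ceil ((2 : ℝ) ^ ((n : ℝ) * R))

/-- The i.i.d. product mass function on sequences of length `n`. -/
def iid {𝒜 : Type} (p : 𝒜 → ℝ) (n : ℕ) : (Fin n → 𝒜) → ℝ :=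
  fun s => ∏ i, p (s i)

/-- A rate pair `(RX, RY)` is achievable for computing `f` at a receiver knowing `Z`,
from separate encodings of `X` and `Y`, when `(X,Y,Z) ~ p` i.i.d. -/
def Achievable {𝒳 𝒴 𝒵 F : Type} [Fintype 𝒳] [Fintype 𝒴] [Fintype 𝒵] [Fintype F]
    (p : 𝒳 × 𝒴 × 𝒵 → ℝ) (f : 𝒳 → 𝒴 → 𝒵 → F) (RX RY : ℝ) : Prop :=
  ∀ ε : ℝ, 0 < ε → ∃ N : ℕ, ∀ n, N ≤ n →
    ∃ (φX : (Fin n → 𝒳) → Fin (codeSize n RX))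
      (φY : (Fin n → 𝒴) → Fin (codeSize n RY))
      (ψ : Fin (codeSize n RX) → Fin (codeSize n RY) → (Fin n → 𝒵) → (Fin n → F)),
      pr (iid p n)
        {s | ψ (φX fun i => (s i).1) (φY fun i => (s i).2.1) (fun i => (s i).2.2)
            ≠ fun i => f (s i).1 (s i).2.1 (s i).2.2} ≤ ε

/-- The rate region: the closure of the set of achievable rate pairs. -/
def RateRegion {𝒳 𝒴 𝒵 F : Type} [Fintype 𝒳] [Fintype 𝒴] [Fintype 𝒵] [Fintype F]
    (p : 𝒳 × 𝒴 × 𝒵 → ℝ) (f : 𝒳 → 𝒴 → 𝒵 → F) : Set (ℝ × ℝ) :=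
  closure {r | Achievable p f r.1 r.2}

/-- Conditional characteristic graph adjacency of `A` given `C`, w.r.t. joint
weights `q` and function `g`. -/
def charAdj {𝒜 𝒞 F : Type} (q : 𝒜 → 𝒞 → ℝ) (g : 𝒜 → 𝒞 → F) (a₁ a₂ : 𝒜) : Prop :=
  a₁ ≠ a₂ ∧ ∃ c, 0 < q a₁ c * q a₂ c ∧ g a₁ c ≠ g a₂ c

/-- Adjacency of the conditional characteristic graph `G_{X|Y,Z}`. -/
def adjXgYZ {𝒳 𝒴 𝒵 F : Type} (p : 𝒳 × 𝒴 × 𝒵 → ℝ) (f : 𝒳 → 𝒴 → 𝒵 → F) : 𝒳 → 𝒳 → Prop :=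
  charAdj (fun x (c : 𝒴 × 𝒵) => p (x, c.1, c.2)) (fun x c => f x c.1 c.2)

/-- Adjacency of the conditional characteristic graph `G_{Y|X,Z}`. -/
def adjYgXZ {𝒳 𝒴 𝒵 F : Type} (p : 𝒳 × 𝒴 × 𝒵 → ℝ) (f : 𝒳 → 𝒴 → 𝒵 → F) : 𝒴 → 𝒴 → Prop :=
  charAdj (fun y (c : 𝒳 × 𝒵) => p (c.1, y, c.2)) (fun y c => f c.1 y c.2)

/-- Adjacency of the conditional characteristic graph `G_{X,Y|Z}`. -/
def adjXYgZ {𝒳 𝒴 𝒵 F : Type} (p : 𝒳 × 𝒴 × 𝒵 → ℝ) (f : 𝒳 → 𝒴 → 𝒵 → F) :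
    (𝒳 × 𝒴) → (𝒳 × 𝒴) → Prop :=
  charAdj (fun a (z : 𝒵) => p (a.1, a.2, z)) (fun a z => f a.1 a.2 z)

/-- `s` is an independent set of the graph with adjacency `adj`. -/
def IndepFinset {𝒜 : Type} (adj : 𝒜 → 𝒜 → Prop) (s : Finset 𝒜) : Prop :=
  ∀ a₁ ∈ s, ∀ a₂ ∈ s, ¬ adj a₁ a₂

/-- `s` is a maximal independent set of the graph with adjacency `adj`. -/
def MaxIndepFinset {𝒜 : Type} (adj : 𝒜 → 𝒜 → Prop) (s : Finset 𝒜) : Prop :=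
  IndepFinset adj s ∧ ∀ t, IndepFinset adj t → s ⊆ t → t = s

/-- Adjacency of the generalized conditional characteristic graph `G_{Y|V,Z}` (a graph on
the values of `Y`): `y₁ ∼ y₂` iff they are distinct and there are `v, z` with
`p(v,y₁,z)·p(v,y₂,z) > 0` on which the function `f̃_X` (computed through the hidden
variable `X`) takes different values. -/
def genAdj {Ω 𝒱 𝒳 𝒴 𝒵 F : Type} [Fintype Ω] (μ : Ω → ℝ)
    (V : Ω → 𝒱) (X : Ω → 𝒳) (Y : Ω → 𝒴) (Z : Ω → 𝒵) (f : 𝒳 → 𝒴 → 𝒵 → F)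
    (y₁ y₂ : 𝒴) : Prop :=
  y₁ ≠ y₂ ∧ ∃ v z x₁ x₂,
    0 < pr μ {ω | V ω = v ∧ X ω = x₁ ∧ Y ω = y₁ ∧ Z ω = z} ∧
    0 < pr μ {ω | V ω = v ∧ X ω = x₂ ∧ Y ω = y₂ ∧ Z ω = z} ∧
    f x₁ y₁ z ≠ f x₂ y₂ z

/-- Conditional graph entropy `H_G(A|C)`: the infimum of `I(V;A|C)` over all joint
distributions `μ` of `(V,A,C)` whose `(A,C)`-marginal is `q`, satisfying the Markov
chain `V − A − C` with `A ∈ V ∈ Γ*(G)`. -/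
def condGraphEnt {𝒜 𝒞 : Type} [Fintype 𝒜] [Fintype 𝒞]
    (adj : 𝒜 → 𝒜 → Prop) (q : 𝒜 × 𝒞 → ℝ) : ℝ :=
  sInf { r : ℝ | ∃ μ : Finset 𝒜 × 𝒜 × 𝒞 → ℝ,
    (∀ a, 0 ≤ μ a) ∧ (∑ a, μ a = 1) ∧
    (∀ x c, (∑ v, μ (v, x, c)) = q (x, c)) ∧
    MarkovChain μ (fun a => a.1) (fun a => a.2.1) (fun a => a.2.2) ∧
    (∀ v x c, 0 < μ (v, x, c) → x ∈ v) ∧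
    (∀ v x c, 0 < μ (v, x, c) → MaxIndepFinset adj v) ∧
    r = condMutInf μ (fun a => a.1) (fun a => a.2.1) (fun a => a.2.2) }

/-- The support set `{x : p(v,x) > 0}` attached to an index `v` of `V`. -/
def suppSet {Ω 𝒱 𝒜 : Type} [Fintype Ω] [Fintype 𝒜] (μ : Ω → ℝ)
    (V : Ω → 𝒱) (X : Ω → 𝒜) (v : 𝒱) : Finset 𝒜 :=
  Finset.univ.filter (fun x => 0 < pr μ {ω | V ω = v ∧ X ω = x})

/-- The support-set random variable `S_X(V) = (V, {x : p(V,x) > 0})`. -/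
def suppVar {Ω 𝒱 𝒜 : Type} [Fintype Ω] [Fintype 𝒜] (μ : Ω → ℝ)
    (V : Ω → 𝒱) (X : Ω → 𝒜) : Ω → 𝒱 × Finset 𝒜 :=
  fun ω => (V ω, suppSet μ V X (V ω))

section Prob

variable {Ω 𝒜 ℬ : Type} [Fintype Ω] {μ : Ω → ℝ}

theorem pr_mono (hμ : ∀ ω, 0 ≤ μ ω) {E E' : Set Ω} (h : E ⊆ E') : pr μ E ≤ pr μ E' := by
  refine Finset.sum_le_sum fun ω _ => ?_
  by_cases hE : ω ∈ E
  · simp [hE, h hE]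
  · simp only [hE, if_false]
    split_ifs
    exacts [hμ ω, le_rfl]

theorem pr_nonneg (hμ : ∀ ω, 0 ≤ μ ω) (E : Set Ω) : 0 ≤ pr μ E := by
  refine Finset.sum_nonneg fun ω _ => ?_
  split_ifs
  exacts [hμ ω, le_rfl]

theorem pr_pos_iff (hμ : ∀ ω, 0 ≤ μ ω) {E : Set Ω} : 0 < pr μ E ↔ ∃ ω ∈ E, 0 < μ ω := by
  have h : ∀ ω ∈ (univ : Finset Ω), 0 ≤ if ω ∈ E then μ ω else 0 := fun ω _ => by
    split_ifs
    exacts [hμ ω, le_rfl]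
  rw [pr, Finset.sum_pos_iff_of_nonneg h]
  refine ⟨fun ⟨ω, _, hω⟩ => ?_, fun ⟨ω, hE, hω⟩ => ⟨ω, mem_univ ω, by simpa [hE] using hω⟩⟩
  by_cases hE : ω ∈ E
  · exact ⟨ω, hE, by simpa [hE] using hω⟩
  · simp [hE] at hω

theorem pr_eq_pr_iff_of_subset (hμ : ∀ ω, 0 ≤ μ ω) {E E' : Set Ω} (h : E ⊆ E') :
    pr μ E = pr μ E' ↔ ∀ ω ∈ E', 0 < μ ω → ω ∈ E := by
  rw [pr, pr, Finset.sum_eq_sum_iff_of_le]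
  · refine ⟨fun H ω hE' hω => ?_, fun H ω _ => ?_⟩
    · by_contra hE
      have := H ω (mem_univ ω)
      simp [hE, hE'] at this
      exact hω.ne this
    · by_cases hE' : ω ∈ E'
      · rcases (hμ ω).eq_or_lt with h0 | h0
        · simp [← h0]
        · simp [hE', H ω hE' h0]
      · simp [hE', show ω ∉ E from fun hE => hE' (h hE)]
  · intro ω _
    by_cases hE : ω ∈ E
    · simp [hE, h hE]
    · simp only [hE, if_false]
      split_ifs
      exacts [hμ ω, le_rfl]

theorem sum_law_mul [Fintype 𝒜] (X : Ω → 𝒜) (g : 𝒜 → ℝ) :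
    ∑ a, law μ X a * g a = ∑ ω, μ ω * g (X ω) := by
  simp only [law, pr, Finset.sum_mul, Set.mem_ofPred_eq, ite_mul, zero_mul]
  rw [Finset.sum_comm]
  simp

theorem law_prod_le (hμ : ∀ ω, 0 ≤ μ ω) (X : Ω → 𝒜) (Y : Ω → ℬ) (a : 𝒜) (b : ℬ) :
    law μ (fun ω => (X ω, Y ω)) (a, b) ≤ law μ Y b :=
  pr_mono hμ fun _ h => (Prod.mk.inj h).2

theorem law_self_pos (hμ : ∀ ω, 0 ≤ μ ω) (X : Ω → 𝒜) {ω : Ω} (hω : 0 < μ ω) :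
    0 < law μ X (X ω) :=
  (pr_pos_iff hμ).2 ⟨ω, rfl, hω⟩

/-- `H(X|Y) = 0` iff `X` is determined by `Y` on the support of `μ`. -/
theorem condEnt_eq_zero_iff [Fintype 𝒜] [Fintype ℬ] (hμ : ∀ ω, 0 ≤ μ ω)
    (X : Ω → 𝒜) (Y : Ω → ℬ) :
    condEnt μ X Y = 0 ↔ ∀ ω ω', 0 < μ ω → 0 < μ ω' → Y ω = Y ω' → X ω = X ω' := by
  have key : condEnt μ X Y = ∑ ω, μ ω * (Real.logb 2 (law μ Y (Y ω)) -
      Real.logb 2 (law μ (fun ω => (X ω, Y ω)) (X ω, Y ω))) := by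
    rw [condEnt, ent, ent, sum_law_mul, sum_law_mul]
    simp only [mul_sub, Finset.sum_sub_distrib]
    ring
  have hnonneg : ∀ ω ∈ (univ : Finset Ω), 0 ≤ μ ω * (Real.logb 2 (law μ Y (Y ω)) -
      Real.logb 2 (law μ (fun ω => (X ω, Y ω)) (X ω, Y ω))) := fun ω _ => by
    rcases (hμ ω).eq_or_lt with h0 | h0
    · simp [← h0]
    · exact mul_nonneg h0.le (sub_nonneg.2 (Real.logb_le_logb_of_le one_lt_two
        (law_self_pos hμ (fun ω => (X ω, Y ω)) h0) (law_prod_le hμ X Y _ _)))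
  have hterm : ∀ ω, 0 < μ ω → (μ ω * (Real.logb 2 (law μ Y (Y ω)) -
      Real.logb 2 (law μ (fun ω => (X ω, Y ω)) (X ω, Y ω))) = 0 ↔
      ∀ ω', 0 < μ ω' → Y ω = Y ω' → X ω = X ω') := fun ω hω => by
    rw [mul_eq_zero, or_iff_right hω.ne', sub_eq_zero,
      (Real.logb_injOn_pos one_lt_two).eq_iff (law_self_pos hμ Y hω)
        (law_self_pos hμ (fun ω => (X ω, Y ω)) hω), eq_comm, law, law,
      pr_eq_pr_iff_of_subset hμ (Set.ofPred_subset_ofPred.2 fun _ h => (Prod.mk.inj h).2)]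
    simp only [Set.mem_ofPred_eq, Prod.mk.injEq]
    exact ⟨fun H ω' h' e => (H ω' e.symm h').1.symm,
      fun H ω' e h' => ⟨(H ω' h' e.symm).symm, e⟩⟩
  rw [key, Finset.sum_eq_zero_iff_of_nonneg hnonneg]
  refine ⟨fun H ω ω' hω => (hterm ω hω).1 (H ω (mem_univ ω)) ω', fun H ω _ => ?_⟩
  rcases (hμ ω).eq_or_lt with h0 | h0
  · simp [← h0]
  · exact (hterm ω h0).2 fun ω' => H ω ω' h0

/-- Under `U − V − W`, if `p(u,v) > 0` and `p(v,w) > 0` then `p(u,v,w) > 0`. -/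
theorem MarkovChain.exists_pos {𝒞 : Type} {U : Ω → 𝒜} {V : Ω → ℬ} {W : Ω → 𝒞}
    (h : MarkovChain μ U V W) (hμ : ∀ ω, 0 ≤ μ ω) {ω ω' : Ω} (hω : 0 < μ ω) (hω' : 0 < μ ω')
    (hV : V ω = V ω') : ∃ η, 0 < μ η ∧ U η = U ω ∧ V η = V ω ∧ W η = W ω' := by
  have hpos : 0 < pr μ {η | U η = U ω ∧ V η = V ω} * pr μ {η | V η = V ω ∧ W η = W ω'} :=
    mul_pos ((pr_pos_iff hμ).2 ⟨ω, ⟨rfl, rfl⟩, hω⟩) ((pr_pos_iff hμ).2 ⟨ω', ⟨hV.symm, rfl⟩, hω'⟩)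
  rw [← h] at hpos
  obtain ⟨η, hη, hη0⟩ := (pr_pos_iff hμ).1 (pos_of_mul_pos_left hpos (pr_nonneg hμ _))
  exact ⟨η, hη0, hη⟩

end Prob

/-- Lemma 3, claim c: for `(V,X,Y,W,Z) ~ p` on the canonical sample space
satisfying the Markov chains `V − X − (Y,W,Z)` and `(V,X,Z) − Y − W`,
`H(f(X,Y,Z)|V,W,Z) = 0` iff for all `v, w, z`, all `x₁, x₂` in the support set of `v`
and all `y₁, y₂` in the support set of `w` with `p(x₁,y₁,z)·p(x₂,y₂,z) > 0`, one has
`f(x₁,y₁,z) = f(x₂,y₂,z)`. -/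
theorem zero_cond_entropy_iff_support_condition
    (𝒱 𝒳 𝒴 𝒲 𝒵 F : Type)
    [Fintype 𝒱] [Fintype 𝒳] [Fintype 𝒴] [Fintype 𝒲] [Fintype 𝒵] [Fintype F]
    (p : 𝒱 × 𝒳 × 𝒴 × 𝒲 × 𝒵 → ℝ) (hp0 : ∀ a, 0 ≤ p a) (hp1 : ∑ a, p a = 1)
    (f : 𝒳 → 𝒴 → 𝒵 → F)
    (hMk1 : MarkovChain p (fun a => a.1) (fun a => a.2.1)
      (fun a => (a.2.2.1, a.2.2.2.1, a.2.2.2.2)))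
    (hMk2 : MarkovChain p (fun a => (a.1, a.2.1, a.2.2.2.2)) (fun a => a.2.2.1)
      (fun a => a.2.2.2.1)) :
    condEnt p (fun a => f a.2.1 a.2.2.1 a.2.2.2.2)
        (fun a => (a.1, a.2.2.2.1, a.2.2.2.2)) = 0 ↔
      ∀ (v : 𝒱) (w : 𝒲) (z : 𝒵) (x₁ x₂ : 𝒳) (y₁ y₂ : 𝒴),
        x₁ ∈ suppSet p (fun a => a.1) (fun a => a.2.1) v →
        x₂ ∈ suppSet p (fun a => a.1) (fun a => a.2.1) v →
        y₁ ∈ suppSet p (fun a => a.2.2.2.1) (fun a => a.2.2.1) w →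
        y₂ ∈ suppSet p (fun a => a.2.2.2.1) (fun a => a.2.2.1) w →
        0 < law p (fun a => (a.2.1, a.2.2.1, a.2.2.2.2)) (x₁, y₁, z)
            * law p (fun a => (a.2.1, a.2.2.1, a.2.2.2.2)) (x₂, y₂, z) →
        f x₁ y₁ z = f x₂ y₂ z := by
  have hpos : ∀ {v x y w z}, x ∈ suppSet p (fun a => a.1) (fun a => a.2.1) v →
      y ∈ suppSet p (fun a => a.2.2.2.1) (fun a => a.2.2.1) w →
      0 < law p (fun a => (a.2.1, a.2.2.1, a.2.2.2.2)) (x, y, z) → 0 < p (v, x, y, w, z) := by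
    intro v x y w z hx hy hxyz
    obtain ⟨⟨v₁, x₁, y₁, w₁, z₁⟩, ⟨rfl, rfl⟩, h₁⟩ := (pr_pos_iff hp0).1 (mem_filter.1 hx).2
    obtain ⟨⟨v₂, x₂, y₂, w₂, z₂⟩, ⟨rfl, rfl⟩, h₂⟩ := (pr_pos_iff hp0).1 (mem_filter.1 hy).2
    obtain ⟨⟨v₃, x₃, y₃, w₃, z₃⟩, e₃, h₃⟩ := (pr_pos_iff hp0).1 hxyz
    obtain ⟨rfl, rfl, rfl⟩ : x₃ = x₁ ∧ y₃ = y₂ ∧ z₃ = z := by simpa using e₃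
    obtain ⟨η, hη, e, ey, ew⟩ := hMk2.exists_pos hp0 h₃ h₂ rfl
    simp only [Prod.mk.injEq] at e ey ew
    obtain ⟨⟨v', x', y', w', z'⟩, hθ, e₁, e₂, e₄⟩ := hMk1.exists_pos hp0 h₁ hη e.2.1.symm
    simp_all
  rw [condEnt_eq_zero_iff hp0]
  constructor
  · intro H v w z x₁ x₂ y₁ y₂ hx₁ hx₂ hy₁ hy₂ hlaw
    have hl₁ := pos_of_mul_pos_left hlaw (pr_nonneg hp0 _)
    have hl₂ := pos_of_mul_pos_right hlaw (pr_nonneg hp0 _)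
    exact H _ _ (hpos hx₁ hy₁ hl₁) (hpos hx₂ hy₂ hl₂) rfl
  · rintro H ⟨v, x₁, y₁, w, z⟩ ⟨v', x₂, y₂, w', z'⟩ h₁ h₂ e
    obtain ⟨rfl, rfl, rfl⟩ : v = v' ∧ w = w' ∧ z = z' := by simpa using e
    refine H v w z x₁ x₂ y₁ y₂ ?_ ?_ ?_ ?_
      (mul_pos (law_self_pos hp0 _ h₁) (law_self_pos hp0 _ h₂)) <;>
      refine mem_filter.2 ⟨mem_univ _, (pr_pos_iff hp0).2 ?_⟩
    exacts [⟨_, ⟨rfl, rfl⟩, h₁⟩, ⟨_, ⟨rfl, rfl⟩, h₂⟩, ⟨_, ⟨rfl, rfl⟩, h₁⟩, ⟨_, ⟨rfl, rfl⟩, h₂⟩]
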